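/- Define the contact pairing on ℝ³ with coordinates (x,u,p) by ω_{(x,u,p)}(a,b,c) = b − p·a for tangent vectors (a,b,c) ∈ ℝ³. Let φ : ℝ³ → ℝ be a C^∞ function and q₀ ∈ ℝ³. Then there exist open sets U ∋ q₀ and V in ℝ³ and a C^∞ diffeomorphism Φ : U → V such that: (i) Φ is a contact transformation, i.e., for every q = (x,u,p) ∈ U and every vector v = (a,b,c) ∈ ℝ³ with ω_q(v) = 0, writing Φ(q) = (X,U',P) and DΦ_q(v) = (A,B,C), one has B − P·A = 0; and (ii) for every twice differentiable function y on an open interval I with y″(x) = φ(x, y(x), y′(x)) and (x, y(x), y′(x)) ∈ U for all x ∈ I, the image Φ({(x, y(x), y′(x)) : x ∈ I}) is contained in a set of the form {(t, z(t), z′(t)) : t ∈ J} for some affine function z(t) = αt + β (a solution of z″ = 0) on an open interval J. -/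

import Mathlib

open Set

open scoped ContDiff Topology

theorem lie_ift {E F : Type} [NormedAddCommGroup E] [NormedSpace ℝ E] [CompleteSpace E]
    [NormedAddCommGroup F] [NormedSpace ℝ F] [CompleteSpace F] {G : E → F} {W : Set E} (hW : IsOpen W)
    {a : E} (ha : a ∈ W) (hG : ContDiffOn ℝ (⊤ : ℕ∞) G W) (e : E ≃L[ℝ] F)
    (he : HasFDerivAt G (e : E →L[ℝ] F) a) :
    ∃ (U : Set E) (V : Set F) (H : F → E), IsOpen U ∧ IsOpen V ∧ a ∈ U ∧ U ⊆ W ∧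
      ContDiffOn ℝ (⊤ : ℕ∞) H V ∧ G '' U = V ∧ (∀ q ∈ U, H (G q) = q) ∧
      (∀ q ∈ V, G (H q) = q) ∧ (∀ q ∈ V, H q ∈ U) := by
  have hGa : ContDiffAt ℝ (⊤ : ℕ∞) G a := hG.contDiffAt (hW.mem_nhds ha)
  let h := hGa.toOpenPartialHomeomorph G he (by simp)
  have hh : (h : E → F) = G := rfl
  have hc : ContinuousOn (fderiv ℝ G) W := hG.continuousOn_fderiv_of_isOpen hW (by simp)
  let S := W ∩ fderiv ℝ G ⁻¹' (range ((↑) : (E ≃L[ℝ] F) → E →L[ℝ] F))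
  have hS : IsOpen S := hc.isOpen_inter_preimage hW ContinuousLinearEquiv.isOpen
  let k := h.restrOpen S hS
  have hk : (k : E → F) = G := rfl
  have hks : k.source = h.source ∩ S := rfl
  refine ⟨k.source, k.target, k.symm, k.open_source, k.open_target, ?_, ?_, ?_, ?_, ?_, ?_, ?_⟩
  · exact ⟨hGa.mem_toOpenPartialHomeomorph_source he (by simp), ha, ⟨e, he.fderiv.symm⟩⟩
  · intro x hx; exact hx.2.1
  · intro x hx
    have h1 : k.symm x ∈ k.source := k.map_target hx
    obtain ⟨e', he'⟩ := h1.2.2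
    have h2 : ContDiffAt ℝ (⊤ : ℕ∞) G (k.symm x) := hG.contDiffAt (hW.mem_nhds h1.2.1)
    refine (k.contDiffAt_symm (f₀' := e') hx ?_ ?_).contDiffWithinAt
    · rw [hk, he']; exact (h2.differentiableAt (by simp)).hasFDerivAt
    · rw [hk]; exact h2
  · rw [← hk]; exact k.image_source_eq_target
  · intro q hq; exact k.left_inv hq
  · intro q hq; exact k.right_inv hq
  · intro q hq; exact k.map_target hq

section superposition
variable {K : Type} [TopologicalSpace K] [CompactSpace K]
variable {E : Type} [NormedAddCommGroup E] [NormedSpace ℝ E]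

/-- pointwise application of operator valued functions -/
noncomputable def lieApp (K : Type) [TopologicalSpace K] [CompactSpace K]
    (E : Type) [NormedAddCommGroup E] [NormedSpace ℝ E]
    (F : Type) [NormedAddCommGroup F] [NormedSpace ℝ F] :
    C(K, E →L[ℝ] F) →L[ℝ] C(K, E) →L[ℝ] C(K, F) :=
  LinearMap.mkContinuous₂
    (LinearMap.mk₂ ℝ (fun (A : C(K, E →L[ℝ] F)) (g : C(K, E)) =>
        (⟨fun t => A t (g t), A.continuous.clm_apply g.continuous⟩ : C(K, F)))
      (by intros; ext; simp) (by intros; ext; simp) (by intros; ext; simp) (by intros; ext; simp))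
    1 (by
      intro A g
      rw [ContinuousMap.norm_le _ (by positivity)]
      intro t
      simp only [LinearMap.mk₂_apply, ContinuousMap.coe_mk, one_mul]
      exact ((A t).le_opNorm _).trans (mul_le_mul (A.norm_coe_le_norm t) (g.norm_coe_le_norm t)
        (norm_nonneg _) (by positivity)))

theorem lieApp_apply {F : Type} [NormedAddCommGroup F] [NormedSpace ℝ F]
    (A : C(K, E →L[ℝ] F)) (g : C(K, E)) (t : K) : lieApp K E F A g t = A t (g t) := rfl

theorem lieApp_norm {F : Type} [NormedAddCommGroup F] [NormedSpace ℝ F]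
    (A : C(K, E →L[ℝ] F)) (g : C(K, E)) : ‖lieApp K E F A g‖ ≤ ‖A‖ * ‖g‖ := by
  rw [ContinuousMap.norm_le _ (by positivity)]
  intro t
  rw [lieApp_apply]
  exact ((A t).le_opNorm _).trans (mul_le_mul (A.norm_coe_le_norm t) (g.norm_coe_le_norm t)
        (norm_nonneg _) (by positivity))

/-- the superposition operator -/
noncomputable def lieSup {F : Type} [NormedAddCommGroup F] [NormedSpace ℝ F]
    (f : C(E, F)) (γ : C(K, E)) : C(K, F) := f.comp γ

theorem lieSup_hasFDerivAt {F : Type} [NormedAddCommGroup F] [NormedSpace ℝ F]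
    (f : C(E, F)) (f' : C(E, E →L[ℝ] F)) (hf : ∀ x, HasFDerivAt f (f' x) x) (γ : C(K, E)) :
    HasFDerivAt (lieSup (K := K) f) (lieApp K E F (lieSup f' γ)) γ := by
  rw [hasFDerivAt_iff_isLittleO_nhds_zero, Asymptotics.isLittleO_iff]
  intro c hc
  have hcont : Continuous (lieSup (K := K) f') := ContinuousMap.continuous_postcomp f'
  obtain ⟨δ, hδ, hd⟩ := Metric.continuous_iff.1 hcont γ c hc
  filter_upwards [Metric.ball_mem_nhds (0 : C(K, E)) hδ] with h hh
  rw [mem_ball_zero_iff] at hh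
  rw [ContinuousMap.norm_le _ (by positivity)]
  intro t
  have key : ∀ z ∈ Metric.ball (γ t) δ, ‖f' z - f' (γ t)‖ ≤ c := by
    intro z hz
    have := hd (γ + ContinuousMap.const K (z - γ t)) (by
      rw [dist_eq_norm, add_sub_cancel_left, ContinuousMap.norm_lt_iff _ hδ]
      intro s
      simpa [dist_eq_norm] using hz)
    rw [dist_eq_norm, ContinuousMap.norm_lt_iff _ hc] at this
    simpa [lieSup] using (this t).le
  have hht : ‖h t‖ ≤ ‖h‖ := h.norm_coe_le_norm t
  have := (convex_ball (γ t) δ).norm_image_sub_le_of_norm_hasFDerivWithin_le'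
    (fun x _ => (hf x).hasFDerivWithinAt) key (Metric.mem_ball_self hδ)
    (y := γ t + h t) (by simpa [dist_eq_norm] using hht.trans_lt hh)
  simp only [add_sub_cancel_left] at this
  refine le_trans ?_ (this.trans (mul_le_mul_of_nonneg_left hht hc.le))
  apply le_of_eq
  rfl

theorem lieSup_contDiff_nat (n : ℕ) : ∀ (F : Type) [NormedAddCommGroup F] [NormedSpace ℝ F]
    (f : C(E, F)), ContDiff ℝ n f → ContDiff ℝ n (lieSup (K := K) f) := by
  induction n with
  | zero =>
    intro F _ _ f hf
    exact contDiff_zero.2 (ContinuousMap.continuous_postcomp f)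
  | succ n ih =>
    intro F _ _ f hf
    obtain ⟨f', hf', hd⟩ := contDiff_succ_iff_hasFDerivAt.1 hf
    refine contDiff_succ_iff_hasFDerivAt.2
      ⟨fun γ => lieApp K E F (lieSup ⟨f', hf'.continuous⟩ γ), ?_,
        fun γ => lieSup_hasFDerivAt f ⟨f', hf'.continuous⟩ hd γ⟩
    exact (lieApp K E F).contDiff.comp (ih _ ⟨f', hf'.continuous⟩ hf')

theorem lieSup_contDiff {F : Type} [NormedAddCommGroup F] [NormedSpace ℝ F]
    (f : C(E, F)) (hf : ContDiff ℝ (⊤ : ℕ∞) f) :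
    ContDiff ℝ (⊤ : ℕ∞) (lieSup (K := K) f) :=
  contDiff_infty.2 fun n => lieSup_contDiff_nat n F f (contDiff_infty.1 hf n)

end superposition

section flow
set_option linter.unusedSectionVars false
variable {E : Type} [NormedAddCommGroup E] [NormedSpace ℝ E] [CompleteSpace E]

theorem lie_proj_cont (g : C(Icc (0 : ℝ) 1, E)) :
    Continuous (fun τ : ℝ => g (projIcc 0 1 zero_le_one τ)) :=
  g.continuous.comp continuous_projIcc

/-- integration operator -/
noncomputable def lieInt (E : Type) [NormedAddCommGroup E] [NormedSpace ℝ E] [CompleteSpace E] :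
    C(Icc (0 : ℝ) 1, E) →L[ℝ] C(Icc (0 : ℝ) 1, E) :=
  LinearMap.mkContinuous
    { toFun := fun g => ⟨fun t => ∫ τ in (0 : ℝ)..t, g (projIcc 0 1 zero_le_one τ),
        (intervalIntegral.continuous_primitive
          (fun a b => (lie_proj_cont g).intervalIntegrable a b) 0).comp continuous_subtype_val⟩
      map_add' := by
        intro g h
        ext t
        simp only [ContinuousMap.coe_mk, ContinuousMap.add_apply]
        exact intervalIntegral.integral_add ((lie_proj_cont g).intervalIntegrable _ _)
          ((lie_proj_cont h).intervalIntegrable _ _)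
      map_smul' := by
        intro c g
        ext t
        simp }
    1 (by
      intro g
      rw [ContinuousMap.norm_le _ (by positivity)]
      intro t
      have := intervalIntegral.norm_integral_le_of_norm_le_const (a := 0) (b := (t : ℝ))
        (f := fun τ : ℝ => g (projIcc 0 1 zero_le_one τ)) (C := ‖g‖)
        (fun x _ => g.norm_coe_le_norm _)
      refine this.trans ?_
      have h1 : |(t : ℝ) - 0| ≤ 1 := by
        rw [sub_zero, abs_of_nonneg t.2.1]; exact t.2.2
      nlinarith [norm_nonneg g])

theorem lieInt_apply (g : C(Icc (0 : ℝ) 1, E)) (t : Icc (0 : ℝ) 1) :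
    lieInt E g t = ∫ τ in (0 : ℝ)..t, g (projIcc 0 1 zero_le_one τ) := rfl

theorem lieInt_norm (g : C(Icc (0 : ℝ) 1, E)) : ‖lieInt E g‖ ≤ ‖g‖ := by
  rw [ContinuousMap.norm_le _ (by positivity)]
  intro t
  have := intervalIntegral.norm_integral_le_of_norm_le_const (a := 0) (b := (t : ℝ))
    (f := fun τ : ℝ => g (projIcc 0 1 zero_le_one τ)) (C := ‖g‖)
    (fun x _ => g.norm_coe_le_norm _)
  refine this.trans ?_
  have h1 : |(t : ℝ) - 0| ≤ 1 := by
    rw [sub_zero, abs_of_nonneg t.2.1]; exact t.2.2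
  nlinarith [norm_nonneg g]

/-- constants -/
noncomputable def lieConst (E : Type) [NormedAddCommGroup E] [NormedSpace ℝ E] :
    E →L[ℝ] C(Icc (0 : ℝ) 1, E) :=
  LinearMap.mkContinuous
    { toFun := fun v => ContinuousMap.const _ v
      map_add' := by intros; rfl
      map_smul' := by intros; rfl }
    1 (by
      intro g
      rw [ContinuousMap.norm_le _ (by positivity)]
      intro t
      rw [one_mul]
      exact le_refl ‖g‖)

theorem lieConst_apply (v : E) (t : Icc (0 : ℝ) 1) : lieConst E v t = v := rfl

theorem lie_zeta (f : C(E, E)) (f' : C(E, E →L[ℝ] E)) (hf : ∀ x, HasFDerivAt f (f' x) x)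
    (s : ℝ) (q : E) (γ : C(Icc (0 : ℝ) 1, E))
    (hγ : γ = lieConst E q + s • lieInt E (lieSup f γ)) :
    ∃ ζ : C(Icc (0 : ℝ) 1, E), ζ ⟨1, by simp⟩ = 0 ∧
      ζ = lieConst E (f q) - lieInt E (lieSup f γ) +
        s • lieInt E (lieApp _ E E (lieSup f' γ) ζ) := by
  refine ⟨⟨fun t => (1 - (t : ℝ)) • f (γ t), by fun_prop⟩, by simp, ?_⟩
  let Γ : ℝ → E := fun t => q + s • ∫ τ in (0 : ℝ)..t, f (γ (projIcc 0 1 zero_le_one τ))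
  have hfc : Continuous (fun τ : ℝ => f (γ (projIcc 0 1 zero_le_one τ))) :=
    lie_proj_cont (lieSup f γ)
  have hΓ : ∀ t, HasDerivAt Γ (s • f (γ (projIcc 0 1 zero_le_one t))) t := by
    intro t
    have := intervalIntegral.integral_hasDerivAt_right (hfc.intervalIntegrable 0 t)
      hfc.stronglyMeasurable.stronglyMeasurableAtFilter hfc.continuousAt
    exact (this.const_smul s).const_add q
  have hΓγ : ∀ t : Icc (0 : ℝ) 1, Γ t = γ t := by
    intro t
    have := DFunLike.congr_fun hγ t
    rw [this]
    simp [Γ, lieConst_apply, lieInt_apply, lieSup]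
  have hΓp : ∀ t ∈ Icc (0 : ℝ) 1, γ (projIcc 0 1 zero_le_one t) = Γ t := by
    intro t ht
    rw [projIcc_of_mem _ ht, ← hΓγ ⟨t, ht⟩]
  have hΓ0 : Γ 0 = q := by simp [Γ]
  have hΓc : Continuous Γ := continuous_iff_continuousAt.2 fun t => (hΓ t).continuousAt
  have hd : ∀ t : ℝ, HasDerivAt (fun t : ℝ => (1 - t) • f (Γ t))
      ((1 - t) • (f' (Γ t)) (s • f (γ (projIcc 0 1 zero_le_one t))) + (-1 : ℝ) • f (Γ t)) t := by
    intro t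
    exact ((hasDerivAt_id t).const_sub 1).smul ((hf (Γ t)).comp_hasDerivAt t (hΓ t))
  ext t
  have hsub : ∀ x ∈ uIcc (0 : ℝ) t, x ∈ Icc (0 : ℝ) 1 := by
    intro x hx
    rw [uIcc_of_le t.2.1] at hx
    exact ⟨hx.1, hx.2.trans t.2.2⟩
  have hint := intervalIntegral.integral_eq_sub_of_hasDerivAt (a := 0) (b := (t : ℝ))
    (fun x _ => hd x) (Continuous.intervalIntegrable (by fun_prop) _ _)
  simp only [hΓ0, hΓγ, sub_zero, one_smul] at hint
  have h3 : (1 - (t : ℝ)) • f (γ t) = f q + ∫ (y : ℝ) in (0 : ℝ)..t,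
      ((1 - y) • (f' (Γ y)) (s • f (γ (projIcc 0 1 zero_le_one y))) + (-1 : ℝ) • f (Γ y)) := by
    rw [hint]; abel
  simp only [ContinuousMap.coe_mk, ContinuousMap.add_apply, ContinuousMap.sub_apply,
    ContinuousMap.smul_apply, lieConst_apply, lieInt_apply]
  rw [h3, sub_add, sub_eq_add_neg]
  congr 1
  rw [neg_sub, ← intervalIntegral.integral_smul, ← intervalIntegral.integral_sub]
  · apply intervalIntegral.integral_congr
    intro x hx
    have hx' := hsub x hx
    simp only [lieApp_apply, lieSup, ContinuousMap.comp_apply, ContinuousMap.coe_mk, hΓp x hx',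
      map_smul, neg_smul, one_smul]
    rw [projIcc_of_mem _ hx', smul_comm]
    abel
  · exact ((lie_proj_cont _).const_smul s).intervalIntegrable _ _
  · exact (lie_proj_cont _).intervalIntegrable _ _

theorem lie_flow (f : E → E) (hf : ContDiff ℝ (⊤ : ℕ∞) f) (q₀ : E) :
    ∃ (W : Set (ℝ × E)) (Fl : ℝ × E → E), IsOpen W ∧ (0, q₀) ∈ W ∧
      ContDiffOn ℝ (⊤ : ℕ∞) Fl W ∧ (∀ q, (0, q) ∈ W → Fl (0, q) = q) ∧
      (∀ p ∈ W, fderiv ℝ Fl p (-1, f p.2) = 0) := by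
  let fc : C(E, E) := ⟨f, hf.continuous⟩
  have hf'c : ContDiff ℝ (⊤ : ℕ∞) (fderiv ℝ f) := (contDiff_infty_iff_fderiv.1 hf).2
  let f'c : C(E, E →L[ℝ] E) := ⟨fderiv ℝ f, hf'c.continuous⟩
  have hfd : ∀ x, HasFDerivAt fc (f'c x) x := fun x =>
    (hf.differentiable (by simp) x).hasFDerivAt
  let N : C(Icc (0 : ℝ) 1, E) → C(Icc (0 : ℝ) 1, E) := lieSup fc
  have hN : ContDiff ℝ (⊤ : ℕ∞) N := lieSup_contDiff fc hf
  have hNd : ∀ γ, HasFDerivAt N (lieApp _ E E (lieSup f'c γ)) γ := fun γ =>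
    lieSup_hasFDerivAt fc f'c hfd γ
  let R : (ℝ × E) × C(Icc (0 : ℝ) 1, E) → C(Icc (0 : ℝ) 1, E) := fun z =>
    - lieConst E z.1.2 - z.1.1 • lieInt E (N z.2)
  let G : (ℝ × E) × C(Icc (0 : ℝ) 1, E) → (ℝ × E) × C(Icc (0 : ℝ) 1, E) := fun z =>
    (z.1, z.2 + R z)
  have hR : ContDiff ℝ (⊤ : ℕ∞) R := by
    have h1 : ContDiff ℝ (⊤ : ℕ∞) (fun z : (ℝ × E) × C(Icc (0 : ℝ) 1, E) => N z.2) :=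
      hN.comp contDiff_snd
    fun_prop
  have hG : ContDiff ℝ (⊤ : ℕ∞) G := contDiff_fst.prodMk (contDiff_snd.add hR)
  let A : (ℝ × E) →L[ℝ] C(Icc (0 : ℝ) 1, E) :=
    - (lieConst E).comp (ContinuousLinearMap.snd ℝ ℝ E) -
      (ContinuousLinearMap.fst ℝ ℝ E).smulRight (lieInt E (N (lieConst E q₀)))
  let e : ((ℝ × E) × C(Icc (0 : ℝ) 1, E)) ≃L[ℝ] ((ℝ × E) × C(Icc (0 : ℝ) 1, E)) :=
    (ContinuousLinearEquiv.refl ℝ (ℝ × E)).skewProd (ContinuousLinearEquiv.refl ℝ _) A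
  let a : (ℝ × E) × C(Icc (0 : ℝ) 1, E) := ((0, q₀), lieConst E q₀)
  have hRa : HasFDerivAt R (A.comp (ContinuousLinearMap.fst ℝ _ _)) a := by
    have h1 : HasFDerivAt (fun z : (ℝ × E) × C(Icc (0 : ℝ) 1, E) => z.1.2)
      ((ContinuousLinearMap.snd ℝ ℝ E).comp (ContinuousLinearMap.fst ℝ _ _)) a :=
      (hasFDerivAt_snd (𝕜 := ℝ) (p := a.1)).comp a hasFDerivAt_fst
    have h2 : HasFDerivAt (fun z : (ℝ × E) × C(Icc (0 : ℝ) 1, E) => z.1.1)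
      ((ContinuousLinearMap.fst ℝ ℝ E).comp (ContinuousLinearMap.fst ℝ _ _)) a :=
      (hasFDerivAt_fst (𝕜 := ℝ) (p := a.1)).comp a hasFDerivAt_fst
    have h3 : HasFDerivAt (fun z : (ℝ × E) × C(Icc (0 : ℝ) 1, E) => lieInt E (N z.2)) _ a :=
      (lieInt E).hasFDerivAt.comp a ((hNd a.2).comp a hasFDerivAt_snd)
    have h4 := ((lieConst E).hasFDerivAt.comp a h1).neg.sub (h2.smul h3)
    refine h4.congr_fderiv ?_
    ext z <;> simp [A, a]
  have hea : HasFDerivAt G (e : _ →L[ℝ] _) a := by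
    have h4 := (hasFDerivAt_fst (𝕜 := ℝ) (p := a)).prodMk
      ((hasFDerivAt_snd (𝕜 := ℝ) (p := a)).add hRa)
    refine h4.congr_fderiv ?_
    ext z <;> simp [e]
  obtain ⟨U, V, H, hU, hV, haU, -, hH, hGU, hHG, hGH, hHV⟩ :=
    lie_ift isOpen_univ (mem_univ a) hG.contDiffOn e hea
  let T : ℝ × E → C(Icc (0 : ℝ) 1, E) := fun p => (H (p, 0)).2
  let W₀ : Set (ℝ × E) := (fun p => (p, (0 : C(Icc (0 : ℝ) 1, E)))) ⁻¹' V
  have hW₀ : IsOpen W₀ := hV.preimage (by fun_prop)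
  have hT : ContDiffOn ℝ (⊤ : ℕ∞) T W₀ := by
    refine contDiff_snd.comp_contDiffOn (hH.comp ?_ (fun p hp => hp))
    exact (contDiff_id.prodMk contDiff_const).contDiffOn
  have hTeq : ∀ p ∈ W₀, T p = lieConst E p.2 + p.1 • lieInt E (N (T p)) := by
    intro p hp
    have h1 : G (H (p, 0)) = (p, 0) := hGH _ hp
    have h2 : (H (p, 0)).1 = p := congrArg Prod.fst h1
    have h3 : (H (p, 0)).2 + R (H (p, 0)) = 0 := congrArg Prod.snd h1
    simp only [R, h2] at h3
    have h4 : T p + (- lieConst E p.2 - p.1 • lieInt E (N (T p))) = 0 := h3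
    rw [← sub_eq_zero, ← h4]
    abel
  have hmem : (0, q₀) ∈ W₀ := by
    have : G a ∈ V := hGU ▸ mem_image_of_mem G haU
    have h2 : G a = ((0, q₀), 0) := by simp [G, R, a]
    rw [h2] at this
    exact this
  let ρ : ℝ × E → ℝ := fun p => |p.1| * ‖lieSup f'c (T p)‖
  have hρ : ContinuousOn ρ W₀ := by
    have h1 : Continuous (lieSup (K := Icc (0 : ℝ) 1) f'c) :=
      ContinuousMap.continuous_postcomp f'c
    exact continuous_fst.abs.continuousOn.mul (h1.comp_continuousOn hT.continuousOn).norm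
  let W := W₀ ∩ ρ ⁻¹' (Iio 1)
  have hW : IsOpen W := hρ.isOpen_inter_preimage hW₀ isOpen_Iio
  let ev : C(Icc (0 : ℝ) 1, E) →L[ℝ] E :=
    ContinuousMap.evalCLM ℝ (⟨1, by simp⟩ : Icc (0 : ℝ) 1)
  refine ⟨W, fun p => ev (T p), hW, ⟨hmem, ?_⟩, ?_, ?_, ?_⟩
  · simp [ρ]
  · exact ev.contDiff.comp_contDiffOn (hT.mono inter_subset_left)
  · intro q hq
    change ev (T (0, q)) = q
    rw [hTeq _ hq.1]
    simp [ev, lieConst_apply]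
  · intro p hp
    have hTd : HasFDerivAt T (fderiv ℝ T p) p :=
      ((hT.contDiffAt (hW₀.mem_nhds hp.1)).differentiableAt (by simp)).hasFDerivAt
    have h5 : HasFDerivAt (fun p => lieConst E p.2 + p.1 • lieInt E (N (T p))) _ p :=
      ((lieConst E).hasFDerivAt.comp p hasFDerivAt_snd).add
        ((hasFDerivAt_fst (𝕜 := ℝ) (p := p)).smul
          ((lieInt E).hasFDerivAt.comp p ((hNd (T p)).comp p hTd)))
    have h6 := hTd.unique (h5.congr_of_eventuallyEq
      (Filter.eventually_of_mem (hW₀.mem_nhds hp.1) hTeq))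
    have h7 := DFunLike.congr_fun h6 (-1, f p.2)
    obtain ⟨ζ, hζ1, hζ⟩ := lie_zeta fc f'c hfd p.1 p.2 (T p) (hTeq p hp.1)
    set η := fderiv ℝ T p (-1, f p.2) with hη
    have h8 : η - ζ = p.1 • lieInt E (lieApp _ E E (lieSup f'c (T p)) (η - ζ)) := by
      rw [map_sub, map_sub, smul_sub]
      nth_rewrite 1 [h7]
      nth_rewrite 1 [hζ]
      simp [N, fc, ← hη]
      abel
    have h9 : ‖η - ζ‖ ≤ ρ p * ‖η - ζ‖ := by
      nth_rewrite 1 [h8]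
      rw [norm_smul, Real.norm_eq_abs, mul_assoc]
      exact mul_le_mul_of_nonneg_left ((lieInt_norm _).trans (lieApp_norm _ _)) (abs_nonneg _)
    have h10 : η = ζ := by
      by_contra hne
      have : 0 < ‖η - ζ‖ := norm_pos_iff.2 (sub_ne_zero.2 hne)
      have h11 : ρ p < 1 := hp.2
      nlinarith
    have h12 := (ev.hasFDerivAt.comp p hTd).fderiv
    have h13 : fderiv ℝ (fun p => ev (T p)) p = ev.comp (fderiv ℝ T p) := h12
    rw [h13, ContinuousLinearMap.comp_apply, ← hη, h10]
    exact hζ1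

end flow

theorem lie_first_integrals (φ : ℝ × ℝ × ℝ → ℝ) (hφ : ContDiff ℝ (⊤ : ℕ∞) φ) (q₀ : ℝ × ℝ × ℝ) :
    ∃ (W : Set (ℝ × ℝ × ℝ)) (A : ℝ × ℝ × ℝ → ℝ × ℝ × ℝ), IsOpen W ∧ q₀ ∈ W ∧
      ContDiffOn ℝ (⊤ : ℕ∞) A W ∧ (∀ q ∈ W, fderiv ℝ A q (1, q.2.2, φ q) = 0) ∧
      (∀ w : ℝ × ℝ, fderiv ℝ A q₀ (0, w) = (0, w)) := by
  let f : ℝ × ℝ × ℝ → ℝ × ℝ × ℝ := fun q => (1, q.2.2, φ q)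
  have hf : ContDiff ℝ (⊤ : ℕ∞) f := by fun_prop
  obtain ⟨W, Fl, hW, hmem, hFl, hFl0, hFlD⟩ := lie_flow f hf q₀
  let j : ℝ × ℝ × ℝ → ℝ × (ℝ × ℝ × ℝ) := fun q => (q₀.1 - q.1, q)
  have hj : ContDiff ℝ (⊤ : ℕ∞) j := by fun_prop
  have hW' : IsOpen (j ⁻¹' W) := hW.preimage hj.continuous
  have hq₀ : q₀ ∈ j ⁻¹' W := by simpa [j] using hmem
  have hA : ContDiffOn ℝ (⊤ : ℕ∞) (fun q => Fl (j q)) (j ⁻¹' W) :=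
    hFl.comp hj.contDiffOn (fun q hq => hq)
  refine ⟨j ⁻¹' W, fun q => Fl (j q), hW', hq₀, hA, ?_, ?_⟩
  · intro q hq
    have h1 : HasFDerivAt Fl (fderiv ℝ Fl (j q)) (j q) :=
      ((hFl.contDiffAt (hW.mem_nhds hq)).differentiableAt (by simp)).hasFDerivAt
    have h2 : HasFDerivAt j ((-ContinuousLinearMap.fst ℝ ℝ (ℝ × ℝ)).prod
        (ContinuousLinearMap.id ℝ (ℝ × ℝ × ℝ))) q :=
      (hasFDerivAt_fst.const_sub q₀.1).prodMk (hasFDerivAt_id q)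
    have h3 : fderiv ℝ (fun q => Fl (j q)) q = _ := (h1.comp q h2).fderiv
    rw [h3]
    exact hFlD (j q) hq
  · intro w
    have h1 : HasFDerivAt (fun q => Fl (j q)) (fderiv ℝ (fun q => Fl (j q)) q₀) q₀ :=
      ((hA.contDiffAt (hW'.mem_nhds hq₀)).differentiableAt (by simp)).hasFDerivAt
    let c : ℝ → ℝ × ℝ × ℝ := fun t => q₀ + t • ((0, w) : ℝ × ℝ × ℝ)
    have hc : HasDerivAt c (0, w) 0 := by
      have h0 := ((hasDerivAt_id (0 : ℝ)).smul_const ((0, w) : ℝ × ℝ × ℝ)).const_add q₀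
      rw [one_smul] at h0
      exact h0
    have hc0 : c 0 = q₀ := by simp [c]
    have h2 := HasFDerivAt.comp_hasDerivAt (0 : ℝ) (by rw [hc0]; exact h1) hc
    refine h2.unique (hc.congr_of_eventuallyEq ?_)
    have h3 : c ⁻¹' (j ⁻¹' W) ∈ 𝓝 (0 : ℝ) :=
      hc.continuousAt.preimage_mem_nhds (by rw [hc0]; exact hW'.mem_nhds hq₀)
    filter_upwards [h3] with t ht
    have h4 : j (c t) = (0, c t) := by simp [j, c]
    have h5 : j (c t) ∈ W := ht
    rw [h4] at h5
    change Fl (j (c t)) = c t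
    rw [h4]
    exact hFl0 _ h5

/-- S. Lie's theorem: every scalar second-order ODE `y'' = φ(x, y, y')` is locally equivalent,
under a contact transformation of the jet space `J¹(ℝ,ℝ) = ℝ³(x,u,p)` (contact form
`du − p dx`), to the trivial equation `z'' = 0`: the transformation maps prolonged graphs of
solutions of `y'' = φ(x,y,y')` into prolonged graphs of affine functions. -/
theorem second_order_ode_contact_trivializable
    (φ : ℝ × ℝ × ℝ → ℝ) (hφ : ContDiff ℝ (⊤ : ℕ∞) φ) (q₀ : ℝ × ℝ × ℝ) :
    ∃ (U V : Set (ℝ × ℝ × ℝ)) (Φ Ψ : ℝ × ℝ × ℝ → ℝ × ℝ × ℝ),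
      IsOpen U ∧ IsOpen V ∧ q₀ ∈ U ∧
      ContDiffOn ℝ (⊤ : ℕ∞) Φ U ∧ ContDiffOn ℝ (⊤ : ℕ∞) Ψ V ∧
      Φ '' U = V ∧ (∀ q ∈ U, Ψ (Φ q) = q) ∧ (∀ q ∈ V, Φ (Ψ q) = q) ∧
      -- (i) Φ is a contact transformation: it preserves the kernel of `du − p dx`
      (∀ q ∈ U, ∀ v : ℝ × ℝ × ℝ,
        v.2.1 - q.2.2 * v.1 = 0 →
        (fderiv ℝ Φ q v).2.1 - (Φ q).2.2 * (fderiv ℝ Φ q v).1 = 0) ∧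
      -- (ii) prolonged solution graphs of `y'' = φ` are mapped into prolonged graphs of
      -- affine functions, i.e. solutions of `z'' = 0`
      (∀ (I : Set ℝ) (y y' : ℝ → ℝ),
        IsOpen I → I.OrdConnected →
        (∀ x ∈ I, HasDerivAt y (y' x) x) →
        (∀ x ∈ I, HasDerivAt y' (φ (x, y x, y' x)) x) →
        (∀ x ∈ I, (x, y x, y' x) ∈ U) →
        ∃ (J : Set ℝ) (α β : ℝ),
          IsOpen J ∧ J.OrdConnected ∧
          Φ '' {q : ℝ × ℝ × ℝ | ∃ x ∈ I, q = (x, y x, y' x)}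
            ⊆ {q : ℝ × ℝ × ℝ | ∃ t ∈ J, q = (t, α * t + β, α)}) := by
  obtain ⟨W, A, hW, hq₀, hA, hAD, hA0⟩ := lie_first_integrals φ hφ q₀
  let f : ℝ × ℝ × ℝ → ℝ × ℝ × ℝ := fun q => (1, q.2.2, φ q)
  let e : ℝ × ℝ × ℝ := (0, 0, 1)
  let M : ℝ × ℝ × ℝ → ℝ × ℝ × ℝ := fun q => fderiv ℝ A q e
  have hA' : ContDiffOn ℝ (⊤ : ℕ∞) (fderiv ℝ A) W := hA.fderiv_of_isOpen hW (by simp)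
  have hM : ContDiffOn ℝ (⊤ : ℕ∞) M W := hA'.clm_apply contDiffOn_const
  have hM0 : M q₀ = (0, 0, 1) := hA0 (0, 1)
  let W' := W ∩ (fun q => (M q).2.2) ⁻¹' {0}ᶜ
  have hW' : IsOpen W' :=
    (hM.continuousOn.snd.snd).isOpen_inter_preimage hW isOpen_compl_singleton
  have hq₀' : q₀ ∈ W' := ⟨hq₀, by simp [hM0]⟩
  let X : ℝ × ℝ × ℝ → ℝ := fun q => -(M q).2.1 / (M q).2.2
  have hX : ContDiffOn ℝ (⊤ : ℕ∞) X W' := by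
    have h1 := hM.mono (inter_subset_left : W' ⊆ W)
    exact h1.snd.fst.neg.div h1.snd.snd (fun q hq => hq.2)
  let Φ : ℝ × ℝ × ℝ → ℝ × ℝ × ℝ := fun q => (X q, (A q).2.1 + (A q).2.2 * X q, (A q).2.2)
  have hΦ : ContDiffOn ℝ (⊤ : ℕ∞) Φ W' := by
    have h1 := hA.mono (inter_subset_left : W' ⊆ W)
    exact hX.prodMk ((h1.snd.fst.add (h1.snd.snd.mul hX)).prodMk h1.snd.snd)
  have hAd : ∀ q ∈ W, HasFDerivAt A (fderiv ℝ A q) q := fun q hq =>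
    ((hA.contDiffAt (hW.mem_nhds hq)).differentiableAt (by simp)).hasFDerivAt
  have hXd : ∀ q ∈ W', HasFDerivAt X (fderiv ℝ X q) q := fun q hq =>
    ((hX.contDiffAt (hW'.mem_nhds hq)).differentiableAt (by simp)).hasFDerivAt
  have hΦd : ∀ q ∈ W', HasFDerivAt Φ (fderiv ℝ Φ q) q := fun q hq =>
    ((hΦ.contDiffAt (hW'.mem_nhds hq)).differentiableAt (by simp)).hasFDerivAt
  have hΦv : ∀ q ∈ W', ∀ v, fderiv ℝ Φ q v = (fderiv ℝ X q v, (fderiv ℝ A q v).2.1 +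
      ((A q).2.2 * fderiv ℝ X q v + X q * (fderiv ℝ A q v).2.2), (fderiv ℝ A q v).2.2) := by
    intro q hq v
    have h1 := hAd q hq.1
    have h2 := hXd q hq
    have h3 : HasFDerivAt Φ _ q := h2.prodMk ((h1.snd.fst.add (h1.snd.snd.mul h2)).prodMk h1.snd.snd)
    rw [h3.fderiv]
    simp
  have hdec : ∀ q v : ℝ × ℝ × ℝ, v = v.1 • f q + ((0, v.2.1 - q.2.2 * v.1, v.2.2 - φ q * v.1) :
      ℝ × ℝ × ℝ) := by
    rintro q ⟨v1, v2, v3⟩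
    simp only [f, Prod.smul_mk, Prod.mk_add_mk, smul_eq_mul, Prod.mk.injEq]
    refine ⟨?_, ?_, ?_⟩ <;> ring
  -- the derivative of `X` along the field is nonzero at the base point
  have hXf : fderiv ℝ X q₀ (f q₀) = 1 := by
    have hA2 : HasFDerivAt (fderiv ℝ A) (fderiv ℝ (fderiv ℝ A) q₀) q₀ :=
      ((hA'.contDiffAt (hW.mem_nhds hq₀)).differentiableAt (by simp)).hasFDerivAt
    have hφd : HasFDerivAt φ (fderiv ℝ φ q₀) q₀ :=
      (hφ.differentiable (by simp) q₀).hasFDerivAt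
    have hfd : HasFDerivAt f _ q₀ :=
      (hasFDerivAt_const (1 : ℝ) q₀).prodMk
        (((hasFDerivAt_id (𝕜 := ℝ) q₀).snd.snd).prodMk hφd)
    have h1 := (hA2.clm_apply hfd).unique ((hasFDerivAt_const (0 : ℝ × ℝ × ℝ) q₀).congr_of_eventuallyEq
      (Filter.eventually_of_mem (hW.mem_nhds hq₀) hAD))
    have h2 := DFunLike.congr_fun h1 e
    have hsymm : IsSymmSndFDerivAt ℝ A q₀ :=
      (hA.contDiffAt (hW.mem_nhds hq₀)).isSymmSndFDerivAt (by
        simp only [minSmoothness_of_isRCLikeNormedField]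
        exact WithTop.coe_le_coe.2 (le_top : (2 : ℕ∞) ≤ ⊤))
    have h3 : fderiv ℝ (fderiv ℝ A) q₀ (f q₀) e = -(0, 1, fderiv ℝ φ q₀ e) := by
      rw [hsymm.eq, eq_neg_iff_add_eq_zero, ← hA0 (1, fderiv ℝ φ q₀ e)]
      rw [add_comm]
      simpa [e] using h2
    have hMd : HasFDerivAt M _ q₀ := hA2.clm_apply (hasFDerivAt_const e q₀)
    have hX0 : X q₀ = 0 := by simp [X, hM0]
    have h5 := ((hXd q₀ hq₀').mul hMd.snd.snd).unique (hMd.snd.fst.neg.congr_of_eventuallyEq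
      (Filter.eventually_of_mem (hW'.mem_nhds hq₀') (fun q hq => div_mul_cancel₀ _ hq.2)))
    have h6 := DFunLike.congr_fun h5 (f q₀)
    simpa [hM0, hX0, h3] using h6
  have hinj : ∀ v, fderiv ℝ Φ q₀ v = 0 → v = 0 := by
    intro v hv
    rw [hΦv q₀ hq₀' v] at hv
    simp only [Prod.mk_eq_zero] at hv
    obtain ⟨hv1, hv2, hv3⟩ := hv
    have hd := hdec q₀ v
    have h1 : fderiv ℝ A q₀ v = (0, v.2.1 - q₀.2.2 * v.1, v.2.2 - φ q₀ * v.1) := by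
      nth_rewrite 1 [hd]
      rw [map_add, map_smul, hA0]
      have : fderiv ℝ A q₀ (f q₀) = 0 := hAD q₀ hq₀
      rw [this, smul_zero, zero_add]
    rw [h1, hv1] at hv2
    rw [h1] at hv3
    simp only at hv2 hv3
    rw [hv3] at hv2
    have h2 : v.2.1 - q₀.2.2 * v.1 = 0 := by simpa using hv2
    rw [h2, hv3] at hd
    have h3 : v = v.1 • f q₀ := by rw [hd]; simp [f]
    rw [h3, map_smul, hXf] at hv1
    have h4 : v.1 = 0 := by simpa [f] using hv1
    rw [h3, h4, zero_smul]
  let L : (ℝ × ℝ × ℝ) ≃L[ℝ] (ℝ × ℝ × ℝ) :=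
    (LinearEquiv.ofInjectiveEndo (fderiv ℝ Φ q₀ : (ℝ × ℝ × ℝ) →ₗ[ℝ] (ℝ × ℝ × ℝ))
      ((injective_iff_map_eq_zero _).2 hinj)).toContinuousLinearEquiv
  have hL : HasFDerivAt Φ (L : (ℝ × ℝ × ℝ) →L[ℝ] (ℝ × ℝ × ℝ)) q₀ := by
    refine (hΦd q₀ hq₀').congr_fderiv ?_
    rfl
  obtain ⟨U, V, Ψ, hU, hV, hqU, hUW, hΨ, hΦU, hl, hr, -⟩ := lie_ift hW' hq₀' hΦ L hL
  refine ⟨U, V, Φ, Ψ, hU, hV, hqU, hΦ.mono hUW, hΨ, hΦU, hl, hr, ?_, ?_⟩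
  · intro q hq v hv
    have hqW := hUW hq
    have h1 : fderiv ℝ A q v = (v.2.2 - φ q * v.1) • M q := by
      nth_rewrite 1 [hdec q v]
      have h2 : fderiv ℝ A q (f q) = 0 := hAD q hqW.1
      have h3 : ((0, v.2.1 - q.2.2 * v.1, v.2.2 - φ q * v.1) : ℝ × ℝ × ℝ) =
          (v.2.2 - φ q * v.1) • e := by simp [hv, e]
      rw [map_add, map_smul, h2, h3, map_smul, smul_zero, zero_add]
    have h2 : (M q).2.2 ≠ 0 := hqW.2
    have h3 : X q * (M q).2.2 = -(M q).2.1 := div_mul_cancel₀ _ h2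
    rw [hΦv q hqW, h1]
    simp only [Φ, Prod.smul_snd, Prod.smul_fst, smul_eq_mul]
    linear_combination (v.2.2 - φ q * v.1) * h3
  · intro I y y' hI hIc hy hy' hIU
    rcases I.eq_empty_or_nonempty with rfl | ⟨x₀, hx₀⟩
    · exact ⟨univ, 0, 0, isOpen_univ, ordConnected_univ, by simp⟩
    let c : ℝ → ℝ × ℝ × ℝ := fun x => (x, y x, y' x)
    have hc : ∀ x ∈ I, HasDerivAt c (f (c x)) x := fun x hx =>
      (hasDerivAt_id x).prodMk ((hy x hx).prodMk (hy' x hx))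
    have hAc : ∀ x ∈ I, HasDerivAt (fun x => A (c x)) 0 x := by
      intro x hx
      have h1 := (hAd (c x) (hUW (hIU x hx)).1).comp_hasDerivAt x (hc x hx)
      have h2 : fderiv ℝ A (c x) (f (c x)) = 0 := hAD _ (hUW (hIU x hx)).1
      rw [h2] at h1
      exact h1
    have hconst : ∀ x ∈ I, A (c x) = A (c x₀) := fun x hx =>
      hI.is_const_of_deriv_eq_zero hIc.isPreconnected
        (fun x hx => (hAc x hx).differentiableAt.differentiableWithinAt)
        (fun x hx => (hAc x hx).deriv) hx hx₀
    refine ⟨univ, (A (c x₀)).2.2, (A (c x₀)).2.1, isOpen_univ, ordConnected_univ, ?_⟩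
    rintro _ ⟨_, ⟨x, hx, rfl⟩, rfl⟩
    refine ⟨X (c x), mem_univ _, ?_⟩
    have h1 := hconst x hx
    change (X (c x), (A (c x)).2.1 + (A (c x)).2.2 * X (c x), (A (c x)).2.2) = _
    rw [h1, add_comm]
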